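/- Winning cycle-path lemma: Let G be a finite simple graph, let C = {1,2,3,4} be a set of 4 colors, and consider a position (a partial proper coloring of G with colors from C) with Alice to move. Suppose G contains a path P = v_0 v_1 … v_d all of whose vertices are uncolored, where each vertex of P has degree at least 2 and has at least 8 uncolored pendant neighbors, and suppose there are two distinct colors a, b with {a, b} ⊆ Φ(v_0). Suppose further that v_d lies on a cycle of odd length all of whose vertices are uncolored and each of whose vertices has at least 8 uncolored pendant neighbors, the cycle meeting P only in v_d, and let w be a neighbor of v_d on this cycle. If either (i) d is even and Φ(w) ∩ {a, b} ≠ ∅, or (ii) d is odd and Φ(w) ∩ (C \ {a, b}) ≠ ∅, then the position is winning for Bob. -/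

import Mathlib

namespace GCN

/-- The player whose turn it is. -/
inductive Player : Type
  | alice : Player
  | bob : Player

variable {V α : Type}

/-- A move consisting of coloring the uncolored vertex `v` with color `a` is legal in the
partial coloring `c` if `v` is uncolored and no neighbor of `v` has color `a`. -/
def legalMove (G : SimpleGraph V) (c : V → Option α) (v : V) (a : α) : Prop :=
  c v = none ∧ ∀ u, G.Adj v u → c u ≠ some a

/-- The partial coloring obtained by coloring vertex `v` with color `a`. -/
def applyMove [DecidableEq V] (c : V → Option α) (v : V) (a : α) : V → Option α :=
  Function.update c v (some a)

/-- `BobWins G p c` : in the coloring game on `G` starting from the partial coloring `c` with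
player `p` to move (the moving player must color an uncolored vertex properly whenever a legal
move exists; the game ends when no legal move exists), Bob has a strategy guaranteeing that the
game ends with some vertex uncolored. -/
inductive BobWins [DecidableEq V] (G : SimpleGraph V) : Player → (V → Option α) → Prop
  | endPos (p : Player) (c : V → Option α)
      (hend : ∀ v a, ¬ legalMove G c v a) (hunc : ∃ v, c v = none) : BobWins G p c
  | aliceMove (c : V → Option α)
      (hmoves : ∃ v a, legalMove G c v a)
      (h : ∀ v a, legalMove G c v a → BobWins G .bob (applyMove c v a)) :
      BobWins G .alice c
  | bobMove (c : V → Option α) (v : V) (a : α)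
      (hmove : legalMove G c v a)
      (h : BobWins G .alice (applyMove c v a)) : BobWins G .bob c

/-- `AliceWins G p c` : in the coloring game on `G` starting from the partial coloring `c` with
player `p` to move, Alice has a strategy guaranteeing that the game ends with all vertices
colored. -/
inductive AliceWins [DecidableEq V] (G : SimpleGraph V) : Player → (V → Option α) → Prop
  | endPos (p : Player) (c : V → Option α)
      (hend : ∀ v a, ¬ legalMove G c v a) (hall : ∀ v, c v ≠ none) : AliceWins G p c
  | aliceMove (c : V → Option α) (v : V) (a : α)
      (hmove : legalMove G c v a)
      (h : AliceWins G .bob (applyMove c v a)) : AliceWins G .alice c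
  | bobMove (c : V → Option α)
      (hmoves : ∃ v a, legalMove G c v a)
      (h : ∀ v a, legalMove G c v a → AliceWins G .alice (applyMove c v a)) :
      AliceWins G .bob c

/-- The game chromatic number of `G` : the least number `k` of colors such that Alice has a
winning strategy in the coloring game on `G` played with `k` colors (Alice moving first,
starting from the everywhere-uncolored position). -/
noncomputable def gameChromaticNumber [DecidableEq V] (G : SimpleGraph V) : ℕ :=
  sInf {k : ℕ | AliceWins (α := Fin k) G .alice (fun _ => none)}

/-- `c` is a partial proper coloring of `G` : adjacent colored vertices get distinct colors. -/
def ProperPartial (G : SimpleGraph V) (c : V → Option α) : Prop :=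
  ∀ ⦃u v : V⦄, G.Adj u v → ∀ a : α, c u = some a → c v ≠ some a

/-- `Phi G c v` : the set of colors appearing (under `c`) on the neighbors of `v`. -/
def Phi (G : SimpleGraph V) (c : V → Option α) (v : V) : Set α :=
  {a : α | ∃ u, G.Adj v u ∧ c u = some a}

end GCN

namespace GCN

section PendantGame

variable {V : Type} {G : SimpleGraph V} {c : V → Option (Fin 4)}

lemma not_mem_phi_of_legalMove {u : V} {x : Fin 4} (h : legalMove G c u x) :
    x ∉ Phi G c u := by
  rintro ⟨z, hz, hzx⟩
  exact h.2 z hz hzx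

section

variable [DecidableEq V]

lemma applyMove_of_ne {u y : V} (x : Fin 4) (h : y ≠ u) : applyMove c u x y = c y :=
  Function.update_of_ne h _ _

lemma phi_subset_phi_applyMove {u : V} (x : Fin 4) (hu : c u = none) (y : V) :
    Phi G c y ⊆ Phi G (applyMove c u x) y := by
  rintro a ⟨z, hz, hza⟩
  refine ⟨z, hz, ?_⟩
  rw [applyMove_of_ne, hza]
  rintro rfl
  simp [hu] at hza

lemma mem_phi_applyMove {u y : V} (x : Fin 4) (h : G.Adj y u) :
    x ∈ Phi G (applyMove c u x) y :=
  ⟨u, h, Function.update_self _ _ _⟩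

lemma bobWins_alice_of_forall {v : V} (hv : c v = none)
    (h : ∀ u x, legalMove G c u x → BobWins G .bob (applyMove c u x)) :
    BobWins G .alice c := by
  by_cases hm : ∃ u x, legalMove G c u x
  · exact .aliceMove c hm h
  · push Not at hm
    exact .endPos _ c hm ⟨v, hv⟩

/-- An uncolored vertex seeing all colors can never be colored. -/
lemma bobWins_of_phi_eq_univ [Finite V] (p : Player) {v : V} (hv : c v = none)
    (hΦ : ∀ a, a ∈ Phi G c v) : BobWins G p c := by
  induction hk : {u : V | c u = none}.ncard using Nat.strong_induction_on generalizing c p with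
  | _ k ih =>
    subst hk
    have key : ∀ q u x, legalMove G c u x → BobWins G q (applyMove c u x) := by
      intro q u x hux
      have hvu : v ≠ u := by
        rintro rfl
        exact not_mem_phi_of_legalMove hux (hΦ x)
      refine ih _ ?_ q ((applyMove_of_ne x hvu).trans hv)
        (fun a => phi_subset_phi_applyMove x hux.1 v (hΦ a)) rfl
      refine Set.ncard_lt_ncard ⟨fun z hz => ?_, fun hsub => ?_⟩
      · by_cases hzu : z = u
        · subst hzu; exact hux.1
        · exact (applyMove_of_ne x hzu).symm.trans hz
      · have := hsub (show u ∈ {u : V | c u = none} from hux.1)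
        simp [applyMove] at this
    cases p with
    | alice => exact bobWins_alice_of_forall hv (key _)
    | bob =>
      by_cases hm : ∃ u x, legalMove G c u x
      · obtain ⟨u, x, hux⟩ := hm
        exact .bobMove c u x hux (key _ u x hux)
      · push Not at hm
        exact .endPos _ c hm ⟨v, hv⟩

end

variable [Fintype V] [DecidableRel G.Adj]

/-- The uncolored pendant neighbors of `v`. -/
def freePendants (G : SimpleGraph V) [DecidableRel G.Adj] (c : V → Option (Fin 4)) (v : V) :
    Set V :=
  {u : V | G.Adj v u ∧ G.degree u = 1 ∧ c u = none}

lemma eq_of_adj_of_degree_eq_one {u y z : V} (hu : G.degree u = 1) (hy : G.Adj y u)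
    (hz : G.Adj z u) : y = z := by
  obtain ⟨t, ht⟩ := Finset.card_eq_one.mp ((G.card_neighborFinset_eq_degree u).trans hu)
  have h1 : y ∈ G.neighborFinset u := by simpa using hy.symm
  have h2 : z ∈ G.neighborFinset u := by simpa using hz.symm
  rw [ht, Finset.mem_singleton] at h1 h2
  rw [h1, h2]

lemma degree_ne_one_of_freePendants {v : V} (h : 2 ≤ (freePendants G c v).ncard) :
    G.degree v ≠ 1 := by
  have hsub : freePendants G c v ⊆ (G.neighborFinset v : Set V) := fun u hu => by
    simpa using hu.1
  have := Set.ncard_le_ncard hsub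
  rw [Set.ncard_coe_finset, G.card_neighborFinset_eq_degree] at this
  omega

/-- A path of `G`, given as a function on an interval of indices, avoiding pendant vertices. -/
structure IsSegment (G : SimpleGraph V) [DecidableRel G.Adj] (p : ℕ → V) (i j : ℕ) : Prop where
  adj : ∀ n, i ≤ n → n < j → G.Adj (p n) (p (n + 1))
  inj : ∀ m n, i ≤ m → m ≤ j → i ≤ n → n ≤ j → p m = p n → m = n
  deg : ∀ n, i ≤ n → n ≤ j → G.degree (p n) ≠ 1

lemma IsSegment.mono {p : ℕ → V} {i j i' j' : ℕ} (h : IsSegment G p i j) (hi : i ≤ i')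
    (hj : j' ≤ j) : IsSegment G p i' j' where
  adj n h1 h2 := h.adj n (by omega) (by omega)
  inj m n h1 h2 h3 h4 := h.inj m n (by omega) (by omega) (by omega) (by omega)
  deg n h1 h2 := h.deg n (by omega) (by omega)

variable [DecidableEq V]

lemma freePendants_applyMove (u : V) (x : Fin 4) (y : V) :
    freePendants G (applyMove c u x) y = freePendants G c y \ {u} := by
  ext z
  by_cases hz : z = u
  · subst hz; simp [freePendants, applyMove]
  · simp [freePendants, applyMove_of_ne x hz, hz]

lemma ncard_freePendants_le_applyMove_add_one (u : V) (x : Fin 4) (y : V) :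
    (freePendants G c y).ncard ≤ (freePendants G (applyMove c u x) y).ncard + 1 := by
  rw [freePendants_applyMove]
  have := Set.pred_ncard_le_ncard_sdiff_singleton (freePendants G c y) u
  omega

lemma freePendants_applyMove_eq {u y : V} (x : Fin 4) (h : ¬ (G.Adj y u ∧ G.degree u = 1)) :
    freePendants G (applyMove c u x) y = freePendants G c y := by
  rw [freePendants_applyMove, Set.sdiff_singleton_eq_self]
  exact fun hu => h ⟨hu.1, hu.2.1⟩

/-- Bob may show any color to an uncolored vertex having a free pendant neighbor. -/
lemma bobWins_bob_of_pendant {v : V} (x : Fin 4) (hv : c v = none)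
    (hl : 1 ≤ (freePendants G c v).ncard)
    (h : ∀ c' : V → Option (Fin 4),
      (∀ y, G.degree y ≠ 1 → c y = none → c' y = none) →
      (∀ y, Phi G c y ⊆ Phi G c' y) → x ∈ Phi G c' v →
      (∀ y, y ≠ v → freePendants G c' y = freePendants G c y) →
      (freePendants G c v).ncard ≤ (freePendants G c' v).ncard + 1 →
      BobWins G .alice c') :
    BobWins G .bob c := by
  obtain ⟨u, hu⟩ := Set.nonempty_of_ncard_ne_zero (by omega : (freePendants G c v).ncard ≠ 0)
  have hleg : legalMove G c u x := by
    refine ⟨hu.2.2, fun z hz => ?_⟩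
    rw [eq_of_adj_of_degree_eq_one hu.2.1 hz.symm hu.1, hv]
    simp
  refine .bobMove c u x hleg (h _ ?_ (phi_subset_phi_applyMove x hleg.1)
    (mem_phi_applyMove x hu.1) ?_ (ncard_freePendants_le_applyMove_add_one u x v))
  · intro y hy hcy
    rwa [applyMove_of_ne]
    rintro rfl
    exact hy hu.2.1
  · intro y hy
    exact freePendants_applyMove_eq x fun hyu =>
      hy (eq_of_adj_of_degree_eq_one hu.2.1 hyu.1 hu.1)

lemma exists_other {S : Finset (Fin 4)} (hS : S.card = 2) {x : Fin 4} (hx : x ∈ S) :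
    ∃ y, ∀ t ∈ S, t = x ∨ t = y := by
  revert S x
  decide

lemma exists_compl_pair {S : Finset (Fin 4)} (hS : S.card = 2) :
    ∃ s t, ∀ a, a ∈ S ∨ a = s ∨ a = t := by
  revert S
  decide

/-- If `v` sees two colors, Bob can force Alice to color `v`, and then make the neighbor `y`
of `v` see the two other colors. -/
lemma bobWins_bob_of_forcing {v y : V} {S : Finset (Fin 4)} (hS : S.card = 2)
    (hvy : G.Adj v y) (hv : c v = none) (hy : c y = none)
    (hdv : G.degree v ≠ 1) (hdy : G.degree y ≠ 1) (hΦ : ∀ a ∈ S, a ∈ Phi G c v)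
    (hlv : 3 ≤ (freePendants G c v).ncard) (hly : 1 ≤ (freePendants G c y).ncard)
    (h : ∀ c' : V → Option (Fin 4),
      (∀ z, z ≠ v → G.degree z ≠ 1 → c z = none → c' z = none) →
      (∀ z, Phi G c z ⊆ Phi G c' z) → (∀ a ∈ Sᶜ, a ∈ Phi G c' y) →
      (∀ z, z ≠ v → z ≠ y → freePendants G c' z = freePendants G c z) →
      (freePendants G c y).ncard ≤ (freePendants G c' y).ncard + 1 →
      BobWins G .alice c') :
    BobWins G .bob c := by
  obtain ⟨s, t, hst⟩ := exists_compl_pair hS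
  refine bobWins_bob_of_pendant s hv (by omega) fun c₁ hc₁ hm₁ hs₁ hl₁ hlv₁ => ?_
  refine bobWins_alice_of_forall (hc₁ v hdv hv) fun u x hux => ?_
  by_cases huv : u = v
  · subst huv
    have hxt : x = t := by
      have hx := not_mem_phi_of_legalMove hux
      rcases hst x with h' | rfl | h'
      · exact absurd (hm₁ _ (hΦ x h')) hx
      · exact absurd hs₁ hx
      · exact h'
    subst hxt
    have hyu : y ≠ u := hvy.ne'
    have hlu : ∀ z, freePendants G (applyMove c₁ u x) z = freePendants G c₁ z := fun z =>
      freePendants_applyMove_eq x fun hz => hdv hz.2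
    refine bobWins_bob_of_pendant (v := y) s ?_ ?_ fun c₂ hc₂ hm₂ hs₂ hl₂ hly₂ => ?_
    · rw [applyMove_of_ne x hyu]; exact hc₁ y hdy hy
    · rwa [hlu, hl₁ y hyu]
    · refine h c₂ ?_ ?_ ?_ ?_ ?_
      · intro z hzu hdz hz
        refine hc₂ z hdz ?_
        rw [applyMove_of_ne x hzu]
        exact hc₁ z hdz hz
      · exact fun z => (hm₁ z).trans ((phi_subset_phi_applyMove x hux.1 z).trans (hm₂ z))
      · intro a ha
        rcases hst a with h' | rfl | rfl
        · exact absurd h' (Finset.mem_compl.mp ha)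
        · exact hs₂
        · exact hm₂ y (mem_phi_applyMove _ hvy.symm)
      · intro z hzu hzy
        rw [hl₂ z hzy, hlu, hl₁ z hzu]
      · rwa [hlu, hl₁ y hyu] at hly₂
  · have hvu : applyMove c₁ u x v = none := by
      rw [applyMove_of_ne x (Ne.symm huv)]; exact hc₁ v hdv hv
    have hle := ncard_freePendants_le_applyMove_add_one (G := G) (c := c₁) u x v
    refine bobWins_bob_of_pendant t hvu (by omega) fun c₂ hc₂ hm₂ ht₂ _ _ => ?_
    refine bobWins_of_phi_eq_univ _ (hc₂ v hdv hvu) fun a => ?_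
    have hm := (phi_subset_phi_applyMove (G := G) x hux.1 v).trans (hm₂ v)
    rcases hst a with h' | rfl | rfl
    · exact hm (hm₁ _ (hΦ a h'))
    · exact hm hs₁
    · exact ht₂

/-- Alice plays `x` on `u`, and Bob answers by completing the set of colors seen by `v` so
that it contains a given pair `S`, one color of which is already visible after Alice's move. -/
lemma bobWins_bob_of_completing {u v : V} {x : Fin 4} (hux : legalMove G c u x)
    {S : Finset (Fin 4)} (hS : S.card = 2) {z : Fin 4} (hzS : z ∈ S)
    (hz : z ∈ Phi G (applyMove c u x) v) (hvu : v ≠ u) (hv : c v = none)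
    (hl : 2 ≤ (freePendants G c v).ncard)
    (h : ∀ c' : V → Option (Fin 4),
      (∀ y, y ≠ u → G.degree y ≠ 1 → c y = none → c' y = none) →
      (∀ y, Phi G (applyMove c u x) y ⊆ Phi G c' y) →
      (∀ y, Phi G c y ⊆ Phi G c' y) → (∀ a ∈ S, a ∈ Phi G c' v) →
      (∀ y, y ≠ v → ¬ (G.Adj y u ∧ G.degree u = 1) →
        freePendants G c' y = freePendants G c y) →
      (∀ y, (freePendants G c y).ncard ≤ (freePendants G c' y).ncard + 2) →
      (G.degree u ≠ 1 → (freePendants G c v).ncard ≤ (freePendants G c' v).ncard + 1) →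
      BobWins G .alice c') :
    BobWins G .bob (applyMove c u x) := by
  obtain ⟨y, hy⟩ := exists_other hS hzS
  have hle := fun w => ncard_freePendants_le_applyMove_add_one (G := G) (c := c) u x w
  have hlev := hle v
  refine bobWins_bob_of_pendant y ((applyMove_of_ne x hvu).trans hv) (by omega)
    fun c' hc' hm' hy' hl' hlv' => ?_
  refine h c' ?_ hm' ?_ ?_ ?_ ?_ ?_
  · intro w hwu hdw hw
    exact hc' w hdw ((applyMove_of_ne x hwu).trans hw)
  · exact fun w => (phi_subset_phi_applyMove x hux.1 w).trans (hm' w)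
  · intro a ha
    rcases hy a ha with rfl | rfl
    · exact hm' v hz
    · exact hy'
  · intro w hwv hwu
    rw [hl' w hwv, freePendants_applyMove_eq x hwu]
  · intro w
    have := hle w
    by_cases hwv : w = v
    · subst hwv; omega
    · rw [hl' w hwv]; omega
  · intro hdu
    rwa [freePendants_applyMove_eq x fun hw => hdu hw.2] at hlv'

/-- A sequence of pairs of colors, each one complementary to the previous one. -/
structure Alternating (A : ℕ → Finset (Fin 4)) : Prop where
  card : ∀ n, (A n).card = 2
  succ : ∀ n, A (n + 1) = (A n)ᶜ

lemma Alternating.mem_or {A : ℕ → Finset (Fin 4)} (hA : Alternating A) (n : ℕ) (x : Fin 4) :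
    x ∈ A n ∨ x ∈ A (n + 1) := by
  rw [hA.succ, Finset.mem_compl]
  exact em _

lemma Alternating.eq_of_even {A : ℕ → Finset (Fin 4)} (hA : Alternating A) (n : ℕ) {k : ℕ}
    (hk : Even k) : A (n + k) = A n := by
  obtain ⟨r, rfl⟩ := hk
  induction r with
  | zero => rfl
  | succ r ih =>
    rw [show n + (r + 1 + (r + 1)) = n + (r + r) + 1 + 1 by omega, hA.succ, hA.succ, ih,
      compl_compl]

lemma exists_alternating {S : Finset (Fin 4)} (hS : S.card = 2) (i : ℕ) :
    ∃ A, Alternating A ∧ A i = S := by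
  refine ⟨fun n => if Even (n + i) then S else Sᶜ, ⟨fun n => ?_, fun n => ?_⟩, by simp⟩
  · split_ifs
    · exact hS
    · rw [Finset.card_compl, hS]; rfl
  · by_cases h : Even (n + i)
    · have : ¬ Even (n + 1 + i) := by
        rw [show n + 1 + i = n + i + 1 by omega, Nat.even_add_one]; simpa using h
      simp [h, this]
    · have : Even (n + 1 + i) := by
        rw [show n + 1 + i = n + i + 1 by omega, Nat.even_add_one]; exact h
      simp [h, this]

/-- Bob wins on a path whose first vertex sees the pair `A i`, and whose last vertex sees the
complement of the pair `A j` obtained by alternating along the path. -/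
lemma bobWins_of_mismatch {p : ℕ → V} {A : ℕ → Finset (Fin 4)} (hA : Alternating A) {i j : ℕ}
    (hij : i ≤ j) (hp : IsSegment G p i j) (hunc : ∀ n, i ≤ n → n ≤ j → c (p n) = none)
    (hi : ∀ a ∈ A i, a ∈ Phi G c (p i)) (hj : ∀ a ∈ A (j + 1), a ∈ Phi G c (p j))
    (hl : i < j → ∀ n, i ≤ n → n ≤ j → 4 ≤ (freePendants G c (p n)).ncard)
    (hl' : ∀ n, i < n → n < j → 6 ≤ (freePendants G c (p n)).ncard) :
    BobWins G .alice c := by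
  induction hk : j - i using Nat.strong_induction_on generalizing c i j with
  | _ k ih =>
  subst hk
  rcases hij.eq_or_lt with rfl | hlt
  · exact bobWins_of_phi_eq_univ _ (hunc i le_rfl le_rfl)
      fun a => (hA.mem_or i a).elim (hi a) (hj a)
  specialize hl hlt
  refine bobWins_alice_of_forall (hunc i le_rfl hij) fun u x hux => ?_
  have hx := not_mem_phi_of_legalMove hux
  have hne : ∀ m n, i ≤ m → m ≤ j → i ≤ n → n ≤ j → m ≠ n → p m ≠ p n :=
    fun m n h1 h2 h3 h4 h5 h6 => h5 (hp.inj m n h1 h2 h3 h4 h6)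
  by_cases hu : ∃ n, i ≤ n ∧ n ≤ j ∧ u = p n
  · obtain ⟨n, hin, hnj, rfl⟩ := hu
    have hdn := hp.deg n hin hnj
    rcases hA.mem_or n x with hxn | hxn
    · have hin' : i < n := lt_of_le_of_ne hin fun h => hx (h ▸ hi x (h ▸ hxn))
      obtain ⟨m, rfl⟩ : ∃ m, n = m + 1 := ⟨n - 1, by omega⟩
      refine bobWins_bob_of_completing hux (v := p m) (hA.card _) hxn
        (mem_phi_applyMove x (hp.adj m (by omega) (by omega)))
        (hne _ _ (by omega) (by omega) hin hnj (by omega)) (hunc m (by omega) (by omega))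
        (by have := hl m (by omega) (by omega); omega) ?_
      intro c' hc' _ hm hS hl₁ _ hl₂
      have hl₃ : ∀ q, i ≤ q → q < m → freePendants G c' (p q) = freePendants G c (p q) :=
        fun q h1 h2 => hl₁ _ (hne _ _ h1 (by omega) (by omega) (by omega) (by omega))
          fun h => hdn h.2
      specialize hl₂ hdn
      refine ih (m - i) (by omega) (by omega) (hp.mono le_rfl (by omega)) ?_
        (fun a ha => hm _ (hi a ha)) hS ?_ ?_ rfl
      · intro q h1 h2
        exact hc' _ (hne _ _ h1 (by omega) hin hnj (by omega)) (hp.deg q h1 (by omega))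
          (hunc q h1 (by omega))
      · intro him q h1 h2
        rcases h2.eq_or_lt with rfl | h2
        · have := hl' q him (by omega)
          omega
        · rw [hl₃ q h1 h2]
          exact hl q h1 (by omega)
      · intro q h1 h2
        rw [hl₃ q h1.le h2]
        exact hl' q h1 (by omega)
    · have hnj' : n < j := lt_of_le_of_ne hnj fun h => hx (h ▸ hj x (h ▸ hxn))
      refine bobWins_bob_of_completing hux (v := p (n + 1)) (hA.card _) hxn
        (mem_phi_applyMove x (hp.adj n hin hnj').symm)
        (hne _ _ (by omega) (by omega) hin hnj (by omega)) (hunc _ (by omega) (by omega))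
        (by have := hl (n + 1) (by omega) (by omega); omega) ?_
      intro c' hc' _ hm hS hl₁ _ hl₂
      have hl₃ : ∀ q, n + 1 < q → q ≤ j → freePendants G c' (p q) = freePendants G c (p q) :=
        fun q h1 h2 => hl₁ _ (hne _ _ (by omega) h2 (by omega) (by omega) (by omega))
          fun h => hdn h.2
      specialize hl₂ hdn
      refine ih (j - (n + 1)) (by omega) (by omega) (hp.mono (by omega) le_rfl) ?_ hS
        (fun a ha => hm _ (hj a ha)) ?_ ?_ rfl
      · intro q h1 h2
        exact hc' _ (hne _ _ (by omega) h2 hin hnj (by omega)) (hp.deg q (by omega) h2)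
          (hunc q (by omega) h2)
      · intro hnj q h1 h2
        rcases h1.eq_or_lt with rfl | h1
        · have := hl' (n + 1) (by omega) hnj
          omega
        · rw [hl₃ q h1 h2]
          exact hl q (by omega) h2
      · intro q h1 h2
        rw [hl₃ q h1 h2.le]
        exact hl' q (by omega) h2
  · have hpu : ∀ q, i ≤ q → q ≤ j → p q ≠ u := fun q h1 h2 h => hu ⟨q, h1, h2, h.symm⟩
    by_cases hint : ∃ n, i < n ∧ n < j ∧ G.Adj (p n) u ∧ G.degree u = 1
    · obtain ⟨n, hin, hnj, hnu, hdu⟩ := hint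
      have hl6 := hl' n hin hnj
      have hother : ∀ q, i ≤ q → q ≤ j → q ≠ n → ¬ (G.Adj (p q) u ∧ G.degree u = 1) :=
        fun q h1 h2 h3 h4 => hne q n h1 h2 hin.le hnj.le h3
          (eq_of_adj_of_degree_eq_one hdu h4.1 hnu)
      have hcompl : ∀ S : Finset (Fin 4), S.card = 2 → x ∈ S →
          (∀ c' : V → Option (Fin 4), (∀ q, i ≤ q → q ≤ j → c' (p q) = none) →
            (∀ y, Phi G c y ⊆ Phi G c' y) → (∀ a ∈ S, a ∈ Phi G c' (p n)) →
            (∀ q, i ≤ q → q ≤ j → q ≠ n →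
              freePendants G c' (p q) = freePendants G c (p q)) →
            4 ≤ (freePendants G c' (p n)).ncard → BobWins G .alice c') →
          BobWins G .bob (applyMove c u x) := by
        intro S hS hxS h
        refine bobWins_bob_of_completing hux (v := p n) hS hxS (mem_phi_applyMove x hnu)
          (hpu n hin.le hnj.le) (hunc n hin.le hnj.le) (by omega) ?_
        intro c' hc' _ hm hS' hl₁ hl₂ _
        specialize hl₂ (p n)
        refine h c' ?_ hm hS' ?_ (by omega)
        · exact fun q h1 h2 => hc' _ (hpu q h1 h2) (hp.deg q h1 h2) (hunc q h1 h2)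
        · exact fun q h1 h2 h3 => hl₁ _ (hne q n h1 h2 hin.le hnj.le h3) (hother q h1 h2 h3)
      rcases hA.mem_or n x with hxn | hxn
      · refine hcompl _ (hA.card n) hxn fun c' hc' hm hS hl₁ hl₂ => ?_
        refine ih (j - n) (by omega) hnj.le (hp.mono hin.le le_rfl)
          (fun q h1 h2 => hc' q (by omega) h2) hS (fun a ha => hm _ (hj a ha)) ?_ ?_ rfl
        · intro _ q h1 h2
          rcases h1.eq_or_lt with rfl | h1
          · exact hl₂
          · rw [hl₁ q (by omega) h2 (by omega)]
            exact hl q (by omega) h2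
        · intro q h1 h2
          rw [hl₁ q (by omega) h2.le (by omega)]
          exact hl' q (by omega) h2
      · refine hcompl _ (hA.card (n + 1)) hxn fun c' hc' hm hS hl₁ hl₂ => ?_
        refine ih (n - i) (by omega) hin.le (hp.mono le_rfl hnj.le)
          (fun q h1 h2 => hc' q h1 (by omega)) (fun a ha => hm _ (hi a ha)) hS ?_ ?_ rfl
        · intro _ q h1 h2
          rcases h2.eq_or_lt with rfl | h2
          · exact hl₂
          · rw [hl₁ q h1 (by omega) (by omega)]
            exact hl q h1 (by omega)
        · intro q h1 h2
          rw [hl₁ q h1.le (by omega) (by omega)]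
          exact hl' q h1 (by omega)
    · have hunc₁ : ∀ q, i ≤ q → q ≤ j → applyMove c u x (p q) = none := fun q h1 h2 =>
        (applyMove_of_ne x (hpu q h1 h2)).trans (hunc q h1 h2)
      have hm₁ := phi_subset_phi_applyMove (G := G) x hux.1
      have hle := fun q =>
        ncard_freePendants_le_applyMove_add_one (G := G) (c := c) u x (p q)
      have hl₁ : ∀ q, i < q → q < j →
          freePendants G (applyMove c u x) (p q) = freePendants G c (p q) :=
        fun q h1 h2 => freePendants_applyMove_eq x fun h => hint ⟨q, h1, h2, h⟩
      have hli := hl i le_rfl hij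
      have hlj := hl j hij le_rfl
      have hlei := hle i
      have hlej := hle j
      by_cases hju : G.Adj (p j) u ∧ G.degree u = 1
      · have hliu : freePendants G (applyMove c u x) (p i) = freePendants G c (p i) :=
          freePendants_applyMove_eq x fun h => hne i j le_rfl hij hij le_rfl hlt.ne
            (eq_of_adj_of_degree_eq_one h.2 h.1 hju.1)
        obtain ⟨m, rfl⟩ : ∃ m, j = m + 1 := ⟨j - 1, by omega⟩
        have hlm := hl m (by omega) (by omega)
        have hlem := hle m
        refine bobWins_bob_of_forcing (hA.card (m + 1 + 1))
          (hp.adj m (by omega) (by omega)).symm (hunc₁ _ hij le_rfl)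
          (hunc₁ m (by omega) (by omega)) (hp.deg _ hij le_rfl)
          (hp.deg m (by omega) (by omega)) (fun a ha => hm₁ _ (hj a ha)) (by omega)
          (by omega) fun c' hc' hm hS hl₂ hl₃ => ?_
        rw [hA.succ, compl_compl] at hS
        have hl₄ : ∀ q, i ≤ q → q < m → freePendants G c' (p q) = freePendants G c (p q) := by
          intro q h1 h2
          rw [hl₂ _ (hne _ _ h1 (by omega) (by omega) (by omega) (by omega))
            (hne _ _ h1 (by omega) (by omega) (by omega) (by omega))]
          rcases h1.eq_or_lt with rfl | h1
          · exact hliu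
          · exact hl₁ q h1 (by omega)
        refine ih (m - i) (by omega) (by omega) (hp.mono le_rfl (by omega)) ?_
          (fun a ha => hm _ (hm₁ _ (hi a ha))) hS ?_ ?_ rfl
        · exact fun q h1 h2 => hc' _ (hne _ _ h1 (by omega) (by omega) le_rfl (by omega))
            (hp.deg q h1 (by omega)) (hunc₁ q h1 (by omega))
        · intro him q h1 h2
          rcases h2.eq_or_lt with rfl | h2
          · have := hl' q him (by omega)
            rw [hl₁ q him (by omega)] at hl₃
            omega
          · rw [hl₄ q h1 h2]
            exact hl q h1 (by omega)
        · intro q h1 h2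
          rw [hl₄ q h1.le h2]
          exact hl' q h1 (by omega)
      · have hlju : freePendants G (applyMove c u x) (p j) = freePendants G c (p j) :=
          freePendants_applyMove_eq x hju
        have hlm := hl (i + 1) (by omega) (by omega)
        have hlem := hle (i + 1)
        refine bobWins_bob_of_forcing (hA.card i) (hp.adj i le_rfl hlt) (hunc₁ _ le_rfl hij)
          (hunc₁ (i + 1) (by omega) (by omega)) (hp.deg _ le_rfl hij)
          (hp.deg (i + 1) (by omega) (by omega)) (fun a ha => hm₁ _ (hi a ha)) (by omega)
          (by omega) fun c' hc' hm hS hl₂ hl₃ => ?_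
        rw [← hA.succ] at hS
        have hl₄ : ∀ q, i + 1 < q → q ≤ j →
            freePendants G c' (p q) = freePendants G c (p q) := by
          intro q h1 h2
          rw [hl₂ _ (hne _ _ (by omega) h2 (by omega) (by omega) (by omega))
            (hne _ _ (by omega) h2 (by omega) (by omega) (by omega))]
          rcases h2.eq_or_lt with rfl | h2
          · exact hlju
          · exact hl₁ q (by omega) h2
        refine ih (j - (i + 1)) (by omega) (by omega) (hp.mono (by omega) le_rfl) ?_ hS
          (fun a ha => hm _ (hm₁ _ (hj a ha))) ?_ ?_ rfl
        · exact fun q h1 h2 => hc' _ (hne _ _ (by omega) h2 le_rfl hij (by omega))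
            (hp.deg q (by omega) h2) (hunc₁ q (by omega) h2)
        · intro hij' q h1 h2
          rcases h1.eq_or_lt with rfl | h1
          · have := hl' (i + 1) (by omega) hij'
            rw [hl₁ (i + 1) (by omega) hij'] at hl₃
            omega
          · rw [hl₄ q h1 h2]
            exact hl q (by omega) h2
        · intro q h1 h2
          rw [hl₄ q h1 h2.le]
          exact hl' q (by omega) h2

/-- Bob wins when a path `p i, …, p d` leads to an odd cycle `p d, …, p (d + k)`, the first
vertex of the path seeing the pair `A i` and the last vertex of the cycle seeing a color of the
pair `A d`. -/
lemma bobWins_of_segment_to_cycle {p : ℕ → V} {A : ℕ → Finset (Fin 4)} (hA : Alternating A)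
    {i d k : ℕ} (hid : i ≤ d) (hk : Even k) (hk2 : 2 ≤ k) (hp : IsSegment G p i (d + k))
    (hclose : G.Adj (p d) (p (d + k)))
    (hunc : ∀ n, i ≤ n → n ≤ d + k → c (p n) = none)
    (hi : ∀ a ∈ A i, a ∈ Phi G c (p i))
    {z : Fin 4} (hzA : z ∈ A d) (hz : z ∈ Phi G c (p (d + k)))
    (hl : ∀ n, i ≤ n → n ≤ d + k → 7 ≤ (freePendants G c (p n)).ncard)
    (hl' : ∀ n, i < n → n ≤ d + k → 8 ≤ (freePendants G c (p n)).ncard) :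
    BobWins G .alice c := by
  induction hr : d - i using Nat.strong_induction_on generalizing c i with
  | _ r ih =>
  subst hr
  refine bobWins_alice_of_forall (hunc i le_rfl (by omega)) fun u x hux => ?_
  have hx := not_mem_phi_of_legalMove hux
  have hne : ∀ m n, i ≤ m → m ≤ d + k → i ≤ n → n ≤ d + k → m ≠ n → p m ≠ p n :=
    fun m n h1 h2 h3 h4 h5 h6 => h5 (hp.inj m n h1 h2 h3 h4 h6)
  have hl5 : ∀ c' : V → Option (Fin 4),
      (∀ y, (freePendants G c y).ncard ≤ (freePendants G c' y).ncard + 2) →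
      ∀ n, i ≤ n → n ≤ d + k → 4 ≤ (freePendants G c' (p n)).ncard := by
    intro c' h n h1 h2
    have := h (p n)
    have := hl n h1 h2
    omega
  have hl6 : ∀ c' : V → Option (Fin 4),
      (∀ y, (freePendants G c y).ncard ≤ (freePendants G c' y).ncard + 2) →
      ∀ n, i < n → n ≤ d + k → 6 ≤ (freePendants G c' (p n)).ncard := by
    intro c' h n h1 h2
    have := h (p n)
    have := hl' n h1 h2
    omega
  have hl2 : ∀ n, i ≤ n → n ≤ d + k → 2 ≤ (freePendants G c (p n)).ncard :=
    fun n h1 h2 => by have := hl n h1 h2; omega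
  have hAk : A (d + k) = A d := hA.eq_of_even d hk
  by_cases hu : ∃ n, i ≤ n ∧ n ≤ d ∧ u = p n
  · obtain ⟨n, hin, hnd, rfl⟩ := hu
    have hdn := hp.deg n hin (by omega)
    rcases hA.mem_or n x with hxn | hxn
    · have hin' : i < n := lt_of_le_of_ne hin fun h => hx (h ▸ hi x (h ▸ hxn))
      obtain ⟨m, rfl⟩ : ∃ m, n = m + 1 := ⟨n - 1, by omega⟩
      refine bobWins_bob_of_completing hux (v := p m) (hA.card _) hxn
        (mem_phi_applyMove x (hp.adj m (by omega) (by omega)))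
        (hne _ _ (by omega) (by omega) hin (by omega) (by omega))
        (hunc m (by omega) (by omega)) (hl2 m (by omega) (by omega)) ?_
      intro c' hc' _ hm hS _ hl₂ _
      exact bobWins_of_mismatch hA (by omega : i ≤ m) (hp.mono le_rfl (by omega))
        (fun q h1 h2 => hc' _ (hne _ _ h1 (by omega) hin (by omega) (by omega))
          (hp.deg q h1 (by omega)) (hunc q h1 (by omega)))
        (fun a ha => hm _ (hi a ha)) hS (fun _ q h1 h2 => hl5 c' hl₂ q h1 (by omega))
        fun q h1 h2 => hl6 c' hl₂ q h1 (by omega)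
    · rcases hnd.eq_or_lt with rfl | hnd
      · obtain ⟨B, hB, hBn⟩ := exists_alternating (S := {x, z})
          (Finset.card_pair (by
            rintro rfl
            rw [hA.succ, Finset.mem_compl] at hxn
            exact hxn hzA)) (n + 1)
        have hBk : B (n + k + 1) = {x, z} := by
          rw [← hBn, show n + k + 1 = n + 1 + k by omega, hB.eq_of_even _ hk]
        refine bobWins_bob_of_completing hux (v := p (n + 1)) (hB.card (n + 1))
          (z := x) (by simp [hBn]) (mem_phi_applyMove x (hp.adj n hin (by omega)).symm)
          (hne _ _ (by omega) (by omega) hin (by omega) (by omega))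
          (hunc _ (by omega) (by omega)) (hl2 _ (by omega) (by omega)) ?_
        intro c' hc' hm' hm hS _ hl₂ _
        refine bobWins_of_mismatch hB (by omega : n + 1 ≤ n + k) (hp.mono (by omega) le_rfl)
          (fun q h1 h2 => hc' _ (hne _ _ (by omega) h2 hin (by omega) (by omega))
            (hp.deg q (by omega) h2) (hunc q (by omega) h2))
          hS ?_ (fun _ q h1 h2 => hl5 c' hl₂ q (by omega) h2)
          fun q h1 h2 => hl6 c' hl₂ q (by omega) h2.le
        intro a ha
        rw [hBk, Finset.mem_insert, Finset.mem_singleton] at ha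
        rcases ha with rfl | rfl
        · exact hm' _ (mem_phi_applyMove _ hclose.symm)
        · exact hm _ hz
      · refine bobWins_bob_of_completing hux (v := p (n + 1)) (hA.card _) hxn
          (mem_phi_applyMove x (hp.adj n hin (by omega)).symm)
          (hne _ _ (by omega) (by omega) hin (by omega) (by omega))
          (hunc _ (by omega) (by omega)) (hl2 _ (by omega) (by omega)) ?_
        intro c' hc' _ hm hS hl₁ _ hl₂
        specialize hl₂ hdn
        have hl₃ : ∀ q, n + 1 < q → q ≤ d + k →
            freePendants G c' (p q) = freePendants G c (p q) :=
          fun q h1 h2 => hl₁ _ (hne _ _ (by omega) h2 (by omega) (by omega) (by omega))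
            fun h => hdn h.2
        have hl₄ := hl' (n + 1) (by omega) (by omega)
        refine ih (d - (n + 1)) (by omega) (by omega) (hp.mono (by omega) le_rfl)
          (fun q h1 h2 => hc' _ (hne _ _ (by omega) h2 hin (by omega) (by omega))
            (hp.deg q (by omega) h2) (hunc q (by omega) h2)) hS (hm _ hz) ?_ ?_ rfl
        · intro q h1 h2
          rcases h1.eq_or_lt with rfl | h1
          · omega
          · rw [hl₃ q h1 h2]
            exact hl q (by omega) h2
        · intro q h1 h2
          rw [hl₃ q h1 h2]
          exact hl' q (by omega) h2
  · have hpu : ∀ q, i ≤ q → q ≤ d → p q ≠ u := fun q h1 h2 h => hu ⟨q, h1, h2, h.symm⟩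
    by_cases hw : u = p (d + k)
    · subst hw
      rcases hA.mem_or d x with hxd | hxd
      · obtain ⟨m, hm⟩ : ∃ m, d + k = m + 1 := ⟨d + k - 1, by omega⟩
        rw [← hAk, hm] at hxd
        refine bobWins_bob_of_completing hux (v := p m) (hA.card _) hxd
          (mem_phi_applyMove x (by rw [hm]; exact hp.adj m (by omega) (by omega)))
          (hne _ _ (by omega) (by omega) (by omega) (by omega) (by omega))
          (hunc m (by omega) (by omega)) (hl2 m (by omega) (by omega)) ?_
        intro c' hc' _ hm hS _ hl₂ _
        exact bobWins_of_mismatch hA (by omega : i ≤ m) (hp.mono le_rfl (by omega))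
          (fun q h1 h2 => hc' _ (hne _ _ h1 (by omega) (by omega) (by omega) (by omega))
            (hp.deg q h1 (by omega)) (hunc q h1 (by omega)))
          (fun a ha => hm _ (hi a ha)) hS (fun _ q h1 h2 => hl5 c' hl₂ q h1 (by omega))
          fun q h1 h2 => hl6 c' hl₂ q h1 (by omega)
      · refine bobWins_bob_of_completing hux (v := p d) (hA.card _) hxd
          (mem_phi_applyMove x hclose) (hpu d hid le_rfl)
          (hunc d hid (by omega)) (hl2 d hid (by omega)) ?_
        intro c' hc' _ hm hS _ hl₂ _
        exact bobWins_of_mismatch hA hid (hp.mono le_rfl (by omega))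
          (fun q h1 h2 => hc' _ (hpu q h1 h2) (hp.deg q h1 (by omega))
            (hunc q h1 (by omega)))
          (fun a ha => hm _ (hi a ha)) hS (fun _ q h1 h2 => hl5 c' hl₂ q h1 (by omega))
          fun q h1 h2 => hl6 c' hl₂ q h1 (by omega)
    · refine bobWins_bob_of_completing hux (v := p (d + k)) (hA.card d) hzA
        (phi_subset_phi_applyMove x hux.1 _ hz) (Ne.symm hw) (hunc _ (by omega) le_rfl)
        (hl2 _ (by omega) le_rfl) ?_
      intro c' hc' _ hm hS _ hl₂ _
      have hq : ∀ n, n ≤ d + 1 → ∃ m, (if n ≤ d then p n else p (d + k)) = p m ∧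
          (m = n ∧ n ≤ d ∨ n = d + 1 ∧ m = d + k) := by
        intro n hn
        split_ifs with h
        · exact ⟨n, rfl, Or.inl ⟨rfl, h⟩⟩
        · exact ⟨d + k, rfl, Or.inr ⟨by omega, rfl⟩⟩
      refine bobWins_of_mismatch (p := fun n => if n ≤ d then p n else p (d + k)) hA
        (by omega : i ≤ d + 1) ⟨?_, ?_, ?_⟩ ?_ ?_ ?_ ?_ ?_
      · intro n h1 h2
        rcases (Nat.lt_succ_iff.mp h2).eq_or_lt with rfl | h2
        · simpa using hclose
        · simp only [if_pos h2.le, if_pos (Nat.succ_le_of_lt h2)]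
          exact hp.adj n h1 (by omega)
      · intro m n h1 h2 h3 h4 h5
        obtain ⟨m', hm', _⟩ := hq m h2
        obtain ⟨n', hn', _⟩ := hq n h4
        rw [hm', hn'] at h5
        have := hp.inj m' n' (by omega) (by omega) (by omega) (by omega) h5
        omega
      · intro n h1 h2
        obtain ⟨n', hn', _⟩ := hq n h2
        rw [hn']
        exact hp.deg n' (by omega) (by omega)
      · intro n h1 h2
        obtain ⟨n', hn', h'⟩ := hq n h2
        simp only [hn']
        refine hc' _ ?_ (hp.deg n' (by omega) (by omega)) (hunc n' (by omega) (by omega))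
        rcases h' with ⟨rfl, h⟩ | ⟨_, rfl⟩
        · exact hpu _ h1 h
        · exact Ne.symm hw
      · intro a ha
        simp only [if_pos hid]
        exact hm _ (hi a ha)
      · intro a ha
        rw [hA.succ, hA.succ, compl_compl] at ha
        simpa using hS a ha
      · intro _ n h1 h2
        obtain ⟨n', hn', _⟩ := hq n h2
        simp only [hn']
        exact hl5 c' hl₂ n' (by omega) (by omega)
      · intro n h1 h2
        simp only [if_pos (Nat.lt_succ_iff.mp h2)]
        exact hl6 c' hl₂ n h1 (by omega)

end PendantGame

end GCN


open GCN in
/-- Winning cycle-path lemma.  With 4 colors (`Fin 4`), suppose the position `c` is a partial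
proper coloring, Alice to move, and `G` contains a path `P` from `v₀` to `v_d` all of whose
vertices are uncolored, have degree at least 2 and have at least 8 uncolored pendant neighbors,
with `{a, b} ⊆ Φ(v₀)` for distinct colors `a, b`.  Suppose `v_d` lies on a cycle `Cyc` of odd
length, all of whose vertices are uncolored and have at least 8 uncolored pendant neighbors,
meeting `P` only in `v_d`, and let `w` be a neighbor of `v_d` on this cycle.  If either the
length `d` of `P` is even and `Φ(w) ∩ {a, b} ≠ ∅`, or `d` is odd and `Φ(w)` contains one of
the two colors other than `a, b`, then Bob wins. -/
theorem statement7 {V : Type} [Fintype V] [DecidableEq V]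
    (G : SimpleGraph V) [DecidableRel G.Adj]
    (c : V → Option (Fin 4)) (hc : ProperPartial G c)
    {v₀ vd : V} (P : G.Walk v₀ vd) (hP : P.IsPath)
    (huncolP : ∀ v ∈ P.support, c v = none)
    (hdegP : ∀ v ∈ P.support, 2 ≤ G.degree v)
    (hleavesP : ∀ v ∈ P.support,
      8 ≤ {u : V | G.Adj v u ∧ G.degree u = 1 ∧ c u = none}.ncard)
    (a b : Fin 4) (hab : a ≠ b) (h₀ : {a, b} ⊆ Phi G c v₀)
    (Cyc : G.Walk vd vd) (hCyc : Cyc.IsCycle) (hodd : Odd Cyc.length)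
    (huncolC : ∀ v ∈ Cyc.support, c v = none)
    (hleavesC : ∀ v ∈ Cyc.support,
      8 ≤ {u : V | G.Adj v u ∧ G.degree u = 1 ∧ c u = none}.ncard)
    (hmeet : ∀ v ∈ P.support, v ∈ Cyc.support → v = vd)
    (w : V) (hw : s(vd, w) ∈ Cyc.edges)
    (hcond : (Even P.length ∧ (Phi G c w ∩ {a, b}).Nonempty) ∨
             (Odd P.length ∧ (Phi G c w ∩ ({a, b}ᶜ : Set (Fin 4))).Nonempty)) :
    BobWins G .alice c := by
  obtain ⟨D, hD, hDodd, hDsup, hDw⟩ : ∃ D : G.Walk vd vd, D.IsCycle ∧ Odd D.length ∧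
      (∀ v, v ∈ D.support ↔ v ∈ Cyc.support) ∧ D.getVert (D.length - 1) = w := by
    have hmem : w ∈ Cyc.toSubgraph.neighborSet vd := by
      rw [SimpleGraph.Subgraph.mem_neighborSet, ← SimpleGraph.Subgraph.mem_edgeSet]
      simpa using hw
    rw [hCyc.neighborSet_toSubgraph_endpoint] at hmem
    rcases hmem with rfl | rfl
    · refine ⟨Cyc.reverse, hCyc.reverse, by simpa using hodd, by simp, ?_⟩
      have := hCyc.three_le_length
      rw [SimpleGraph.Walk.getVert_reverse, SimpleGraph.Walk.length_reverse]
      congr 1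
      omega
    · exact ⟨Cyc, hCyc, hodd, fun _ => Iff.rfl, rfl⟩
  have hlen := hD.three_le_length
  obtain ⟨k, hk⟩ : ∃ k, D.length = k + 1 := ⟨D.length - 1, by omega⟩
  set d := P.length with hd
  set p : ℕ → V := fun n => if n ≤ d then P.getVert n else D.getVert (n - d) with hpdef
  have hpP : ∀ n, n ≤ d → p n = P.getVert n := fun n hn => if_pos hn
  have hpD : ∀ n, p (d + n) = D.getVert n := by
    intro n
    rcases Nat.eq_zero_or_pos n with rfl | hn
    · simp [hpdef, hd]
    · simp [hpdef, show ¬ d + n ≤ d by omega]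
  have hsplit : ∀ n, n ≤ d ∨ ∃ m, n = d + m ∧ 0 < m := fun n => by
    by_cases h : n ≤ d
    · exact Or.inl h
    · exact Or.inr ⟨n - d, by omega, by omega⟩
  have hmemD : ∀ n, D.getVert n ∈ Cyc.support := fun n =>
    (hDsup _).mp (D.getVert_mem_support n)
  have hunc : ∀ n, c (p n) = none := by
    intro n
    rcases hsplit n with h | ⟨m, rfl, -⟩
    · rw [hpP n h]; exact huncolP _ (P.getVert_mem_support n)
    · rw [hpD]; exact huncolC _ (hmemD m)
  have hleaf : ∀ n, 8 ≤ (freePendants G c (p n)).ncard := by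
    intro n
    rcases hsplit n with h | ⟨m, rfl, -⟩
    · rw [hpP n h]; exact hleavesP _ (P.getVert_mem_support n)
    · rw [hpD]; exact hleavesC _ (hmemD m)
  have hDinj : ∀ m n, m ≤ k → n ≤ k → D.getVert m = D.getVert n → m = n :=
    fun m n hm hn h => hD.getVert_injOn' (by simp [hk, hm]) (by simp [hk, hn]) h
  have hcross : ∀ m n, m ≤ d → 0 < n → n ≤ k → P.getVert m ≠ D.getVert n := by
    intro m n hm hn hnk h
    have hvd := hmeet _ (P.getVert_mem_support m) (h ▸ hmemD n)
    have := hDinj 0 n (by omega) hnk (by rw [D.getVert_zero, ← h, hvd])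
    omega
  have hseg : IsSegment G p 0 (d + k) := by
    refine ⟨fun n _ hn => ?_, fun m n _ hm _ hn h => ?_,
      fun n _ _ => degree_ne_one_of_freePendants (le_trans (by norm_num) (hleaf n))⟩
    · rcases lt_or_ge n d with h | h
      · rw [hpP n h.le, hpP (n + 1) h]
        exact P.adj_getVert_succ h
      · obtain ⟨m, rfl⟩ := Nat.exists_eq_add_of_le h
        rw [add_assoc, hpD, hpD]
        exact D.adj_getVert_succ (by omega)
    · rcases hsplit m with h1 | ⟨m, rfl, h1⟩ <;> rcases hsplit n with h2 | ⟨n, rfl, h2⟩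
      · rw [hpP m h1, hpP n h2] at h
        exact hP.getVert_injOn h1 h2 h
      · rw [hpP m h1, hpD] at h
        exact absurd h (hcross m n h1 h2 (by omega))
      · rw [hpP n h2, hpD] at h
        exact absurd h.symm (hcross n m h2 h1 (by omega))
      · rw [hpD, hpD] at h
        rw [hDinj m n (by omega) (by omega) h]
  have hpw : p (d + k) = w := by rw [hpD, ← hDw, hk, Nat.add_sub_cancel]
  have hclose : G.Adj (p d) (p (d + k)) := by
    have h := D.adj_getVert_succ (by omega : k < D.length)
    rw [← hk, D.getVert_length] at h
    rw [hpD, ← add_zero d, hpD, D.getVert_zero]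
    exact h.symm
  obtain ⟨A, hA, hA0⟩ := exists_alternating (Finset.card_pair hab) 0
  obtain ⟨z, hzw, hzA⟩ : ∃ z, z ∈ Phi G c w ∧ z ∈ A d := by
    rcases hcond with ⟨hev, z, hz, hz'⟩ | ⟨⟨r, hr⟩, z, hz, hz'⟩
    · refine ⟨z, hz, ?_⟩
      rw [← zero_add d, hA.eq_of_even 0 hev, hA0]
      simpa using hz'
    · refine ⟨z, hz, ?_⟩
      rw [hr, hA.succ, ← zero_add (2 * r), hA.eq_of_even 0 (even_two_mul r), hA0]
      simpa using hz'
  refine bobWins_of_segment_to_cycle hA (Nat.zero_le d) (k := k) ?_ (by omega) hseg hclose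
    (fun n _ _ => hunc n) ?_ hzA (hpw ▸ hzw) (fun n _ _ => le_trans (by norm_num) (hleaf n))
    fun n _ _ => hleaf n
  · rw [hk, Nat.odd_add_one, Nat.not_odd_iff_even] at hDodd
    exact hDodd
  · intro a' ha'
    rw [hpP 0 (Nat.zero_le d), P.getVert_zero]
    rw [hA0] at ha'
    exact h₀ (by simpa using ha')
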